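/- Let I be an instance of fair allocation under cardinality constraints with |C_h| ≤ n·k_h for every category h, such that v_i({j}) ≤ μ_i/4 for every agent i and every item j. Then there exists a feasible allocation A = (A_1, …, A_n) with v_i(A_i) ≥ (3/4)·μ_i for every agent i. -/

import Mathlib

open Finset

/-- A partition of all items into `n` (possibly empty) bundles: every item
belongs to exactly one bundle. -/
def IsPartition {M : Type*} {n : ℕ} (A : Fin n → Finset M) : Prop :=
  ∀ j : M, ∃! i, j ∈ A i

/-- A bundle is feasible if it contains at most `k h` items from each category `h`. -/
def FeasibleBundle {M : Type*} {ℓ : ℕ} (cat : M → Fin ℓ) (k : Fin ℓ → ℕ)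
    (B : Finset M) : Prop :=
  ∀ h, (B.filter (fun j => cat j = h)).card ≤ k h

/-- A feasible allocation: a partition of the items into `n` feasible bundles. -/
def FeasibleAlloc {M : Type*} {n ℓ : ℕ} (cat : M → Fin ℓ) (k : Fin ℓ → ℕ)
    (A : Fin n → Finset M) : Prop :=
  IsPartition A ∧ ∀ i, FeasibleBundle cat k (A i)

/-- The maximin share of an agent with additive valuation given by item values `v`,
in the instance with `n` agents, categories `cat` and thresholds `k`. -/
noncomputable def mms (n : ℕ) {M : Type*} {ℓ : ℕ} (cat : M → Fin ℓ)
    (k : Fin ℓ → ℕ) (v : M → ℝ) : ℝ :=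
  sSup {x | ∃ A : Fin n → Finset M, FeasibleAlloc cat k A ∧ x = ⨅ i, ∑ j ∈ A i, v j}

/-- Weighted comparison of two sums, from cardinality and pointwise bounds. -/
lemma mul_sum_le_mul_sum_of_card {α : Type*} (X Y : Finset α) (w : α → ℝ) (hw : ∀ x, 0 ≤ w x)
    (a b : ℕ) (hc : a * #X ≤ b * #Y) (hle : ∀ x ∈ X, ∀ y ∈ Y, w x ≤ w y) :
    a * ∑ x ∈ X, w x ≤ b * ∑ y ∈ Y, w y := by
  rcases Y.eq_empty_or_nonempty with rfl | hY
  · have h : a = 0 ∨ X = ∅ := by simpa using hc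
    rcases h with rfl | rfl <;> simp
  · obtain ⟨y, hy, hmin⟩ := Y.exists_min_image w hY
    have h1 : ∑ x ∈ X, w x ≤ #X * w y := by
      simpa using Finset.sum_le_card_nsmul X w (w y) fun x hx => hle x hx y hy
    have h2 : #Y * w y ≤ ∑ x ∈ Y, w x := by
      simpa using Finset.card_nsmul_le_sum Y w (w y) hmin
    have hc' : (a : ℝ) * #X ≤ b * #Y := by exact_mod_cast hc
    calc (a : ℝ) * ∑ x ∈ X, w x ≤ a * (#X * w y) := by gcongr
      _ = (a * #X) * w y := by ring
      _ ≤ (b * #Y) * w y := mul_le_mul_of_nonneg_right hc' (hw y)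
      _ = b * (#Y * w y) := by ring
      _ ≤ b * ∑ y ∈ Y, w y := by gcongr

/-- The categorywise form of `mul_sum_le_mul_sum_of_card`. -/
lemma mul_sum_le_mul_sum_of_card_fiber {α κ : Type*} [Fintype κ] [DecidableEq κ] (cat : α → κ)
    (X Y : Finset α) (w : α → ℝ) (hw : ∀ x, 0 ≤ w x) (a b : ℕ)
    (hc : ∀ h, a * #{x ∈ X | cat x = h} ≤ b * #{y ∈ Y | cat y = h})
    (hle : ∀ x ∈ X, ∀ y ∈ Y, cat x = cat y → w x ≤ w y) :
    a * ∑ x ∈ X, w x ≤ b * ∑ y ∈ Y, w y := by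
  rw [← Finset.sum_fiberwise X cat w, ← Finset.sum_fiberwise Y cat w, Finset.mul_sum,
    Finset.mul_sum]
  refine Finset.sum_le_sum fun h _ => mul_sum_le_mul_sum_of_card _ _ w hw a b (hc h) ?_
  intro x hx y hy
  rw [Finset.mem_filter] at hx hy
  exact hle x hx.1 y hy.1 (hx.2.trans hy.2.symm)

/-- Every finite set has an upper subset of each possible size. -/
lemma exists_upper_subset_card_eq {α : Type*} [LinearOrder α] (S : Finset α) (s : ℕ)
    (hs : s ≤ #S) : ∃ X ⊆ S, #X = s ∧ ∀ x ∈ X, ∀ y ∈ S \ X, y ≤ x := by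
  induction s with
  | zero => exact ⟨∅, by simp⟩
  | succ s ih =>
    obtain ⟨X, hXS, hX, hup⟩ := ih (by omega)
    have hne : (S \ X).Nonempty := by
      rw [← Finset.card_pos, Finset.card_sdiff_of_subset hXS]
      omega
    have hmax := (S \ X).max'_mem hne
    set z := (S \ X).max' hne
    have hzS := Finset.mem_sdiff.1 hmax
    refine ⟨insert z X, Finset.insert_subset hzS.1 hXS, by simp [hzS.2, hX], ?_⟩
    intro x hx y hy
    have hy' : y ∈ S \ X := by
      simp only [Finset.mem_sdiff, Finset.mem_insert, not_or] at hy ⊢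
      exact ⟨hy.1, hy.2.2⟩
    rcases Finset.mem_insert.1 hx with rfl | hx
    · exact Finset.le_max' _ y hy'
    · exact hup x hx y hy'

/-- The least valuable bundle whose removal leaves at most `c * k h` items of each category. -/
lemma exists_lowest_bundle {α κ : Type*} [LinearOrder α] [DecidableEq κ]
    (cat : α → κ) (k : κ → ℕ) (R : Finset α) (c : ℕ) :
    ∃ B ⊆ R, (∀ h, #{x ∈ B | cat x = h} = #{x ∈ R | cat x = h} - c * k h) ∧
      ∀ x ∈ B, ∀ y ∈ R \ B, cat x = cat y → y ≤ x := by
  choose X hXS hX hup using fun h => exists_upper_subset_card_eq {x ∈ R | cat x = h}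
    (#{x ∈ R | cat x = h} - c * k h) (Nat.sub_le _ _)
  refine ⟨{x ∈ R | x ∈ X (cat x)}, Finset.filter_subset _ _, ?_, ?_⟩
  · intro h
    rw [← hX h]
    congr 1
    ext x
    have := @hXS h x
    simp only [Finset.mem_filter] at this ⊢
    constructor
    · rintro ⟨⟨_, h1⟩, rfl⟩
      exact h1
    · intro hx
      obtain ⟨h1, rfl⟩ := this hx
      exact ⟨⟨h1, hx⟩, rfl⟩
  · intro x hx y hy hxy
    simp only [Finset.mem_filter, Finset.mem_sdiff, not_and] at hx hy
    refine hup (cat x) x hx.2 y ?_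
    simp only [Finset.mem_filter, Finset.mem_sdiff]
    exact ⟨⟨hy.1, hxy.symm⟩, hxy ▸ hy.2 hy.1⟩

/-- Improving a bundle until some agent is satisfied. -/
lemma exists_saturating_bundle {m : ℕ} {κ ι : Type*} [Fintype κ] [DecidableEq κ]
    (cat : Fin m → κ) (k : κ → ℕ) (w : ι → Fin m → ℝ) (hw : ∀ i x, 0 ≤ w i x)
    (hanti : ∀ i x y, cat x = cat y → x ≤ y → w i y ≤ w i x)
    (μ : ι → ℝ) (hμ : ∀ i, 0 ≤ μ i) (hsmall : ∀ i x, w i x ≤ μ i / 4)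
    (R : Finset (Fin m)) (c : ℕ) (hR : ∀ h, #{x ∈ R | cat x = h} ≤ (c + 1) * k h)
    (N : Finset ι) (hN : N.Nonempty) (hval : ∀ i ∈ N, (c + 1) * μ i ≤ ∑ x ∈ R, w i x)
    (B₀ : Finset (Fin m)) (hB₀R : B₀ ⊆ R) (hB₀k : ∀ h, #{x ∈ B₀ | cat x = h} ≤ k h)
    (hB₀ : ∀ i ∈ N, ∑ x ∈ B₀, w i x < 3 / 4 * μ i) :
    ∃ B ⊆ R, (∀ h, #{x ∈ B₀ | cat x = h} ≤ #{x ∈ B | cat x = h}) ∧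
      (∀ h, #{x ∈ B | cat x = h} ≤ k h) ∧ (∃ i ∈ N, 3 / 4 * μ i ≤ ∑ x ∈ B, w i x) ∧
      ∀ i ∈ N, ∑ x ∈ B, w i x ≤ μ i := by
  classical
  by_contra! hcon
  let F : Finset (Finset (Fin m)) := R.powerset.filter fun B =>
    (∀ h, #{x ∈ B₀ | cat x = h} ≤ #{x ∈ B | cat x = h}) ∧
      (∀ h, #{x ∈ B | cat x = h} ≤ k h) ∧ ∀ i ∈ N, ∑ x ∈ B, w i x < 3 / 4 * μ i
  have hF : F.Nonempty := ⟨B₀, by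
    simp only [F, Finset.mem_filter, Finset.mem_powerset]
    exact ⟨hB₀R, fun h => le_rfl, hB₀k, hB₀⟩⟩
  obtain ⟨B, hBF, hmax⟩ := F.exists_max_image (fun B => ∑ x ∈ B, (m - x : ℕ)) hF
  simp only [F, Finset.mem_filter, Finset.mem_powerset] at hBF hmax
  obtain ⟨hBR, hBlow, hBk, hBlt⟩ := hBF
  have improve : ∀ B' ⊆ R, (∀ h, #{x ∈ B | cat x = h} ≤ #{x ∈ B' | cat x = h}) →
      (∀ h, #{x ∈ B' | cat x = h} ≤ k h) →
      (∀ i, ∑ x ∈ B', w i x ≤ ∑ x ∈ B, w i x + μ i / 4) →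
      ∑ x ∈ B', (m - x : ℕ) ≤ ∑ x ∈ B, (m - x : ℕ) := by
    intro B' h1 h2 h3 h4
    have hlow := fun h => (hBlow h).trans (h2 h)
    refine hmax B' ⟨h1, hlow, h3, ?_⟩
    by_contra! hex
    obtain ⟨i, hi, hlt⟩ := hcon B' h1 hlow h3 hex
    have := h4 i
    have := hBlt i hi
    linarith
  have hfull : ∀ x ∈ R \ B, #{y ∈ B | cat y = cat x} = k (cat x) := by
    intro x hx
    rw [Finset.mem_sdiff] at hx
    by_contra hne
    have hlt := lt_of_le_of_ne (hBk (cat x)) hne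
    have := improve (insert x B) (Finset.insert_subset hx.1 hBR)
      (fun h => Finset.card_le_card (Finset.filter_subset_filter _ (Finset.subset_insert _ _)))
      (fun h => by
        rw [Finset.filter_insert]
        split_ifs with hh
        · subst hh
          exact (Finset.card_insert_le _ _).trans hlt
        · exact hBk h)
      (fun i => by
        rw [Finset.sum_insert hx.2]
        linarith [hsmall i x])
    rw [Finset.sum_insert hx.2] at this
    have := x.2
    omega
  have htop : ∀ x ∈ R \ B, ∀ b ∈ B, cat x = cat b → b ≤ x := by
    intro x hx b hb hxb
    rw [Finset.mem_sdiff] at hx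
    by_contra! hlt
    have hx' : x ∉ B.erase b := fun h => hx.2 (Finset.mem_of_mem_erase h)
    have hcard : ∀ h, #{y ∈ insert x (B.erase b) | cat y = h} = #{y ∈ B | cat y = h} := by
      intro h
      rw [Finset.filter_insert, Finset.filter_erase]
      split_ifs with hh
      · rw [Finset.card_insert_of_notMem (by simp [hx.2]),
          Finset.card_erase_add_one (by simp [hb, ← hxb, hh])]
      · rw [Finset.erase_eq_of_notMem (by simp [← hxb, hh])]
    have := improve (insert x (B.erase b))
      (Finset.insert_subset hx.1 ((Finset.erase_subset _ _).trans hBR))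
      (fun h => (hcard h).ge) (fun h => (hcard h).trans_le (hBk h))
      (fun i => by
        rw [Finset.sum_insert hx', ← Finset.add_sum_erase B _ hb]
        linarith [hsmall i x, hw i b])
    rw [Finset.sum_insert hx', ← Finset.add_sum_erase B _ hb] at this
    have h1 := b.2
    have h2 : (x : ℕ) < b := hlt
    omega
  obtain ⟨i, hi⟩ := hN
  have havg := mul_sum_le_mul_sum_of_card_fiber cat (R \ B) B (w i) (hw i) 1 c
    (fun h => by
      by_cases hex : ∃ x ∈ R \ B, cat x = h
      · obtain ⟨x, hx, rfl⟩ := hex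
        have h1 := hfull x hx
        have h2 := hR (cat x)
        have h3 : #{y ∈ R \ B | cat y = cat x} + #{y ∈ B | cat y = cat x} =
            #{y ∈ R | cat y = cat x} := by
          rw [← Finset.card_union_of_disjoint
            (Finset.disjoint_filter_filter Finset.sdiff_disjoint), ← Finset.filter_union,
            Finset.sdiff_union_of_subset hBR]
        rw [h1] at h3 ⊢
        linarith
      · rw [Finset.filter_false_of_mem (by simpa using hex)]
        simp)
    (fun x hx b hb hxb => hanti i b x hxb.symm (htop x hx b hb hxb))
  have hsum := Finset.sum_sdiff (f := w i) hBR
  have h1 := hval i hi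
  have h2 := hBlt i hi
  have h3 := mul_le_mul_of_nonneg_left h2.le (Nat.cast_nonneg (α := ℝ) c)
  have h4 := mul_nonneg (Nat.cast_nonneg (α := ℝ) c) (hμ i)
  have h5 := hμ i
  push_cast at havg
  linarith

/-- A bundle which satisfies one agent and whose removal preserves the average share of
every agent and the cardinality bounds. -/
lemma exists_removable_bundle {m : ℕ} {κ ι : Type*} [Fintype κ] [DecidableEq κ]
    (cat : Fin m → κ) (k : κ → ℕ) (w : ι → Fin m → ℝ) (hw : ∀ i x, 0 ≤ w i x)
    (hanti : ∀ i x y, cat x = cat y → x ≤ y → w i y ≤ w i x)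
    (μ : ι → ℝ) (hμ : ∀ i, 0 ≤ μ i) (hsmall : ∀ i x, w i x ≤ μ i / 4)
    (R : Finset (Fin m)) (c : ℕ) (hR : ∀ h, #{x ∈ R | cat x = h} ≤ (c + 1) * k h)
    (N : Finset ι) (hN : N.Nonempty) (hval : ∀ i ∈ N, (c + 1) * μ i ≤ ∑ x ∈ R, w i x) :
    ∃ B ⊆ R, (∀ h, #{x ∈ B | cat x = h} ≤ k h) ∧ (∀ h, #{x ∈ R \ B | cat x = h} ≤ c * k h) ∧
      (∃ i ∈ N, 3 / 4 * μ i ≤ ∑ x ∈ B, w i x) ∧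
      ∀ i ∈ N, c * μ i ≤ ∑ x ∈ R \ B, w i x := by
  have hsplit : ∀ B ⊆ R, ∀ h, #{y ∈ R \ B | cat y = h} + #{y ∈ B | cat y = h} =
      #{y ∈ R | cat y = h} := fun B hB h => by
    rw [← Finset.card_union_of_disjoint (Finset.disjoint_filter_filter Finset.sdiff_disjoint),
      ← Finset.filter_union, Finset.sdiff_union_of_subset hB]
  obtain ⟨B₀, hB₀R, hB₀card, hB₀low⟩ := exists_lowest_bundle cat k R c
  have hB₀k : ∀ h, #{x ∈ B₀ | cat x = h} ≤ k h := fun h => by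
    have := hR h
    rw [add_one_mul] at this
    have := hB₀card h
    omega
  by_cases hsat : ∃ i ∈ N, 3 / 4 * μ i ≤ ∑ x ∈ B₀, w i x
  · refine ⟨B₀, hB₀R, hB₀k, fun h => ?_, hsat, fun i hi => ?_⟩
    · have := hsplit B₀ hB₀R h
      have := hB₀card h
      omega
    · have havg := mul_sum_le_mul_sum_of_card_fiber cat B₀ (R \ B₀) (w i) (hw i) c 1
        (fun h => by
          have h1 := hsplit B₀ hB₀R h
          have h2 := hB₀card h
          have h3 := Nat.mul_le_mul_left c (hB₀k h)
          rcases Nat.eq_zero_or_pos #{x ∈ B₀ | cat x = h} with h0 | h0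
          · simp [h0]
          · omega)
        (fun x hx y hy hxy => hanti i y x hxy.symm (hB₀low x hx y hy hxy))
      have hsum := Finset.sum_sdiff (f := w i) hB₀R
      have h1 := mul_le_mul_of_nonneg_left (hval i hi) (Nat.cast_nonneg (α := ℝ) c)
      rw [← hsum] at h1
      have hc : (0 : ℝ) < c + 1 := by positivity
      push_cast at havg
      refine le_of_mul_le_mul_left ?_ hc
      linarith
  · push Not at hsat
    obtain ⟨B, hBR, hlow, hBk, hex, hle⟩ := exists_saturating_bundle cat k w hw hanti μ hμ hsmall
      R c hR N hN hval B₀ hB₀R hB₀k hsat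
    refine ⟨B, hBR, hBk, fun h => ?_, hex, fun i hi => ?_⟩
    · have := hsplit B hBR h
      have := hB₀card h
      have := hlow h
      omega
    · have hsum := Finset.sum_sdiff (f := w i) hBR
      have := hval i hi
      have := hle i hi
      linarith

/-- Existence of the allocation when all agents rank each category in the same order. -/
lemma exists_owner_of_ordered {m : ℕ} {κ ι : Type*} [Fintype κ] [DecidableEq κ] [DecidableEq ι]
    [Nonempty ι] (cat : Fin m → κ) (k : κ → ℕ) (w : ι → Fin m → ℝ) (hw : ∀ i x, 0 ≤ w i x)
    (hanti : ∀ i x y, cat x = cat y → x ≤ y → w i y ≤ w i x)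
    (μ : ι → ℝ) (hμ : ∀ i, 0 ≤ μ i) (hsmall : ∀ i x, w i x ≤ μ i / 4)
    (c : ℕ) (N : Finset ι) (hN : #N = c)
    (R : Finset (Fin m)) (hR : ∀ h, #{x ∈ R | cat x = h} ≤ c * k h)
    (hval : ∀ i ∈ N, c * μ i ≤ ∑ x ∈ R, w i x) :
    ∃ o : Fin m → ι, (∀ x ∈ R, o x ∈ N) ∧
      (∀ i h, #{x ∈ R | o x = i ∧ cat x = h} ≤ k h) ∧
      ∀ i ∈ N, 3 / 4 * μ i ≤ ∑ x ∈ R with o x = i, w i x := by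
  induction c generalizing N R with
  | zero =>
    have hR' : R = ∅ := by
      refine Finset.eq_empty_of_forall_notMem fun x hx => ?_
      have := hR (cat x)
      rw [zero_mul, Nat.le_zero, Finset.card_eq_zero, Finset.filter_eq_empty_iff] at this
      exact this hx rfl
    subst hR'
    rw [Finset.card_eq_zero] at hN
    subst hN
    exact ⟨fun _ => Classical.arbitrary ι, by simp, by simp, by simp⟩
  | succ c ih =>
    obtain ⟨B, hBR, hBk, hRB, ⟨i₀, hi₀, hsat⟩, hrest⟩ := exists_removable_bundle cat k w hw hanti
      μ hμ hsmall R c hR N (Finset.card_pos.1 (by omega)) (by exact_mod_cast hval)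
    obtain ⟨o, hoN, hok, hoval⟩ := ih (N.erase i₀) (by rw [Finset.card_erase_of_mem hi₀]; omega)
      (R \ B) hRB (fun i hi => hrest i (Finset.mem_of_mem_erase hi))
    have hne : ∀ x ∈ R, x ∉ B → o x ≠ i₀ := fun x hx hxB =>
      Finset.ne_of_mem_erase (hoN x (Finset.mem_sdiff.2 ⟨hx, hxB⟩))
    have hfst : {x ∈ R | (if x ∈ B then i₀ else o x) = i₀} = B := by
      ext x
      rw [Finset.mem_filter]
      have := hne x
      have := @hBR x
      grind
    have hother : ∀ i ≠ i₀, {x ∈ R | (if x ∈ B then i₀ else o x) = i} =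
        {x ∈ R \ B | o x = i} := by
      intro i hi
      ext x
      simp only [Finset.mem_filter, Finset.mem_sdiff]
      grind
    refine ⟨fun x => if x ∈ B then i₀ else o x, ?_, ?_, ?_⟩
    · intro x hx
      dsimp only
      split_ifs with hxB
      · exact hi₀
      · exact Finset.mem_of_mem_erase (hoN x (Finset.mem_sdiff.2 ⟨hx, hxB⟩))
    · intro i h
      rw [← Finset.filter_filter]
      by_cases hi : i = i₀
      · subst hi
        rw [hfst]
        exact hBk h
      · rw [hother i hi, Finset.filter_filter]
        exact hok i h
    · intro i hiN
      by_cases hi : i = i₀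
      · subst hi
        rw [hfst]
        exact hsat
      · rw [hother i hi]
        exact hoval i (Finset.mem_erase.2 ⟨hi, hiN⟩)

/-- Real values on a finite linear order can be rearranged decreasingly. -/
lemma exists_perm_antitone {α : Type*} [Fintype α] [LinearOrder α] (f : α → ℝ) :
    ∃ σ : Equiv.Perm α, Antitone (f ∘ σ) := by
  let e := Fintype.orderIsoFinOfCardEq α rfl
  let g : Fin (Fintype.card α) → ℝ := fun x => -f (e x)
  refine ⟨(e.symm.toEquiv.trans (Tuple.sort g)).trans e.toEquiv, fun x y hxy => ?_⟩
  have := Tuple.monotone_sort g (e.symm.monotone hxy)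
  simpa [g] using this

/-- Values can be rearranged decreasingly within each category. -/
lemma exists_perm_antitone_fiber {α κ : Type*} [Fintype α] [LinearOrder α] [DecidableEq κ]
    (cat : α → κ) (f : α → ℝ) : ∃ σ : Equiv.Perm α, (∀ x, cat (σ x) = cat x) ∧
      ∀ x y, cat x = cat y → x ≤ y → f (σ y) ≤ f (σ x) := by
  choose σ hσ using fun h : κ => exists_perm_antitone (fun x : {x // cat x = h} => f x)
  refine ⟨Equiv.ofFiberEquiv σ, Equiv.ofFiberEquiv_map σ, ?_⟩
  have hval : ∀ h (x : {x // cat x = h}), Equiv.ofFiberEquiv σ x = σ h x := by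
    rintro _ ⟨x, rfl⟩
    rfl
  intro x y hxy hle
  have h1 := hval (cat y) ⟨x, hxy⟩
  have h2 := hval (cat y) ⟨y, rfl⟩
  dsimp only at h1 h2
  rw [h1, h2]
  exact hσ (cat y) (show (⟨x, hxy⟩ : {x // cat x = cat y}) ≤ ⟨y, rfl⟩ from hle)

/-- The owner of each position in the common order can be matched with an item which is at
least as good, in her valuation, as the item in that position of her own ranking. -/
lemma exists_perm_ge_of_owner {α κ ι : Type*} [Fintype α] [LinearOrder α] [Fintype κ]
    [DecidableEq κ] (cat : α → κ) (v : ι → α → ℝ) (σ : ι → Equiv.Perm α)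
    (hcat : ∀ i x, cat (σ i x) = cat x)
    (hanti : ∀ i x y, cat x = cat y → x ≤ y → v i (σ i y) ≤ v i (σ i x)) (o : α → ι) :
    ∃ τ : Equiv.Perm α, (∀ x, cat (τ x) = cat x) ∧
      ∀ x, v (o x) (σ (o x) x) ≤ v (o x) (τ x) := by
  let T : α → Finset α := fun x =>
    ({a | a ≤ x ∧ cat a = cat x} : Finset α).map (σ (o x)).toEmbedding
  have hT : ∀ x, ∀ y ∈ T x, cat y = cat x ∧ v (o x) (σ (o x) x) ≤ v (o x) y := by
    intro x y hy
    simp only [T, Finset.mem_map, Finset.mem_filter, Finset.mem_univ, true_and] at hy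
    obtain ⟨a, ⟨hax, hc⟩, rfl⟩ := hy
    exact ⟨(hcat _ a).trans hc, hanti _ a x hc hax⟩
  obtain ⟨f, hf, hfT⟩ := (Finset.all_card_le_biUnion_card_iff_exists_injective T).1 (by
    intro s
    rw [Finset.card_eq_sum_card_fiberwise (f := cat) (t := univ) (by simp),
      Finset.card_eq_sum_card_fiberwise (s := s.biUnion T) (f := cat) (t := univ) (by simp)]
    refine Finset.sum_le_sum fun h _ => ?_
    rcases ({x ∈ s | cat x = h} : Finset α).eq_empty_or_nonempty with h0 | h0
    · simp [h0]
    · have hmem := Finset.max'_mem _ h0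
      set z := Finset.max' _ h0
      obtain ⟨hzs, hzh⟩ := Finset.mem_filter.1 hmem
      calc #{x ∈ s | cat x = h} ≤ #(T z) := by
            rw [Finset.card_map]
            refine Finset.card_le_card fun x hx => ?_
            have := Finset.le_max' _ x hx
            simp only [Finset.mem_filter, Finset.mem_univ, true_and] at hx ⊢
            exact ⟨this, hx.2.trans hzh.symm⟩
        _ ≤ _ := by
            refine Finset.card_le_card fun y hy => ?_
            rw [Finset.mem_filter, Finset.mem_biUnion]
            exact ⟨⟨z, hzs, hy⟩, (hT z y hy).1.trans hzh⟩)
  exact ⟨Equiv.ofBijective f (Finite.injective_iff_bijective.1 hf),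
    fun x => (hT x _ (hfT x)).1, fun x => (hT x _ (hfT x)).2⟩

lemma mms_nonneg (n : ℕ) {M : Type*} {ℓ : ℕ} (cat : M → Fin ℓ) (k : Fin ℓ → ℕ) (v : M → ℝ)
    (hv : ∀ j, 0 ≤ v j) : 0 ≤ mms n cat k v := by
  refine Real.sSup_nonneg ?_
  rintro _ ⟨A, -, rfl⟩
  exact Real.iInf_nonneg fun i => Finset.sum_nonneg fun j _ => hv j

/-- The maximin share is at most the average share. -/
lemma mul_mms_le_sum {n : ℕ} (hn : 1 ≤ n) {M : Type*} [Fintype M] {ℓ : ℕ}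
    (cat : M → Fin ℓ) (k : Fin ℓ → ℕ) (v : M → ℝ) (hv : ∀ j, 0 ≤ v j) :
    n * mms n cat k v ≤ ∑ j, v j := by
  classical
  have hn' : (0 : ℝ) < n := by exact_mod_cast hn
  rw [mul_comm, ← le_div_iff₀ hn']
  refine Real.sSup_le ?_ (div_nonneg (Finset.sum_nonneg fun j _ => hv j) hn'.le)
  rintro _ ⟨A, hA, rfl⟩
  rw [le_div_iff₀ hn', mul_comm]
  have hdisj : Set.PairwiseDisjoint (↑(univ : Finset (Fin n))) A := by
    intro i _ i' _ hne
    refine Finset.disjoint_left.2 fun j hj hj' => hne ?_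
    exact (hA.1 j).unique hj hj'
  calc n * ⨅ i, ∑ j ∈ A i, v j = ∑ _i' : Fin n, ⨅ i, ∑ j ∈ A i, v j := by simp
    _ ≤ ∑ i, ∑ j ∈ A i, v j :=
        Finset.sum_le_sum fun i _ => ciInf_le (Set.finite_range _).bddBelow i
    _ = ∑ j ∈ univ.biUnion A, v j := (Finset.sum_biUnion hdisj).symm
    _ ≤ ∑ j, v j := Finset.sum_le_univ_sum_of_nonneg hv

/-- If every item is worth at most `μ i / 4` to each agent `i`, then
there is a feasible allocation giving every agent at least `(3/4) · μ i`. -/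
theorem stmt_16 {m ℓ n : ℕ} (hn : 1 ≤ n)
    (cat : Fin m → Fin ℓ) (k : Fin ℓ → ℕ)
    (hcard : ∀ h, (univ.filter (fun x => cat x = h)).card ≤ n * k h)
    (v : Fin n → Fin m → ℝ) (hv : ∀ i j, 0 ≤ v i j)
    (hsmall : ∀ i j, v i j ≤ mms n cat k (v i) / 4) :
    ∃ A : Fin n → Finset (Fin m), FeasibleAlloc cat k A ∧
      ∀ i, 3 / 4 * mms n cat k (v i) ≤ ∑ j ∈ A i, v i j := by
  have : Nonempty (Fin n) := ⟨⟨0, hn⟩⟩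
  choose σ hσcat hσ using fun i => exists_perm_antitone_fiber cat (v i)
  obtain ⟨o, -, hok, hoval⟩ := exists_owner_of_ordered cat k (fun i x => v i (σ i x))
    (fun i x => hv i _) hσ (fun i => mms n cat k (v i))
    (fun i => mms_nonneg n cat k (v i) (hv i)) (fun i x => hsmall i _) n univ (by simp) univ
    hcard (fun i _ => by
      rw [Equiv.sum_comp (σ i) (v i)]
      exact mul_mms_le_sum hn cat k (v i) (hv i))
  obtain ⟨τ, hτcat, hτ⟩ := exists_perm_ge_of_owner cat v σ hσcat hσ o
  have hmap : ∀ i, ({x | o (τ.symm x) = i} : Finset (Fin m)) =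
      ({x | o x = i} : Finset (Fin m)).map τ.toEmbedding := by
    intro i
    ext x
    simp [Finset.mem_map_equiv]
  refine ⟨fun i => {x | o (τ.symm x) = i}, ⟨fun j => ⟨o (τ.symm j), by simp, by simp⟩, ?_⟩, ?_⟩
  · intro i h
    dsimp only
    rw [hmap, Finset.filter_map, Finset.card_map, Finset.filter_filter]
    simpa [hτcat] using hok i h
  · intro i
    dsimp only
    rw [hmap, Finset.sum_map]
    refine (hoval i (Finset.mem_univ i)).trans (Finset.sum_le_sum fun x hx => ?_)
    obtain rfl := (Finset.mem_filter.1 hx).2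
    exact hτ x
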